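/- Let K ⊴ M be finite groups and suppose there exist subgroups K_0, V̂ ≤ M with K = K_0(K ∩ V̂), Ĥ := K ∩ V̂ ≤ Z(K), and M = K V̂. Suppose every character in a given M-stable subset 𝕂 ⊆ Irr(K) restricts to a multiple of irreducible characters of K_0 in a set 𝕂_0, and there exist extension maps with respect to Ĥ ⊴ V̂ and with respect to K_0 ⊴ K_0 ⋊ (V̂/Ĥ) for 𝕂_0 (with suitable equivariance). Then every λ ∈ 𝕂 extends to its inertia group M_λ. -/

import Mathlib

open CategoryTheory

/-- `f` is an irreducible (complex) character of the finite group `G`. -/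
def IsIrrChar (G : Type) [Group G] (f : G → ℂ) : Prop :=
  ∃ V : FDRep ℂ G, Simple V ∧ f = FDRep.character V

/-- The inertia group of a function `μ` on a subgroup `A` of `M` inside a subgroup `B` of `M`
(where conjugation by `B` stabilizes `A`): the elements of `B` fixing `μ` under conjugation. -/
def inertia {M : Type*} [Group M] (A B : Subgroup M)
    (hAB : ∀ b ∈ B, ∀ a ∈ A, b * a * b⁻¹ ∈ A) (μ : A → ℂ) : Subgroup M where
  carrier := {b : M | ∃ hb : b ∈ B, ∀ a : A, μ ⟨b * a * b⁻¹, hAB b hb a a.2⟩ = μ a}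
  one_mem' := ⟨B.one_mem, fun a => congrArg μ (Subtype.ext (by group))⟩
  mul_mem' := by
    rintro x y ⟨hx, hfx⟩ ⟨hy, hfy⟩
    refine ⟨B.mul_mem hx hy, fun a => ?_⟩
    have h1 : (⟨x * y * a * (x * y)⁻¹, hAB _ (B.mul_mem hx hy) a a.2⟩ : A)
        = ⟨x * (⟨y * a * y⁻¹, hAB y hy a a.2⟩ : A) * x⁻¹,
            hAB x hx _ (hAB y hy a a.2)⟩ := Subtype.ext (by group)
    rw [h1, hfx, hfy]
  inv_mem' := by
    rintro x ⟨hx, hfx⟩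
    refine ⟨B.inv_mem hx, fun a => ?_⟩
    have h := hfx ⟨x⁻¹ * a * x⁻¹⁻¹, hAB x⁻¹ (B.inv_mem hx) a a.2⟩
    have h2 : (⟨x * (⟨x⁻¹ * a * x⁻¹⁻¹, hAB x⁻¹ (B.inv_mem hx) a a.2⟩ : A) * x⁻¹,
        hAB x hx _ (hAB x⁻¹ (B.inv_mem hx) a a.2)⟩ : A) = a := Subtype.ext (by group)
    rw [h2] at h
    exact h.symm

/-- `Λ` is an extension of `μ ∈ Irr(A)` to the subgroup `B ⊇ A`. -/
def IsExtension {M : Type*} [Group M] {A B : Subgroup M} (hle : A ≤ B)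
    (μ : A → ℂ) (Λ : B → ℂ) : Prop :=
  ∀ a : A, Λ ⟨a, hle a.2⟩ = μ a

/-- Conjugation by elements of `V` stabilizes `K ⊓ V` when `K` is normal. -/
lemma conj_mem_inf {M : Type*} [Group M] {K V : Subgroup M} (hK : K.Normal) :
    ∀ b ∈ V, ∀ a ∈ (K ⊓ V : Subgroup M), b * a * b⁻¹ ∈ K ⊓ V :=
  fun b hb a ha => ⟨hK.conj_mem a ha.1 b, V.mul_mem (V.mul_mem hb ha.2) (V.inv_mem hb)⟩


def AbsIrr {G W : Type} [Group G] [AddCommGroup W] [Module ℂ W] (ρ : G →* (W →ₗ[ℂ] W)) : Prop :=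
  Nontrivial W ∧ ∀ f : W →ₗ[ℂ] W, (∀ g, f * ρ g = ρ g * f) → ∃ c : ℂ, f = c • 1

def endHom {G : Type} [Group G] (V : FDRep ℂ G) (f : V →ₗ[ℂ] V)
    (hf : ∀ g, f * V.ρ g = V.ρ g * f) : V ⟶ V :=
  ⟨InducedCategory.homMk (ModuleCat.ofHom f), fun g ↦ by
    ext1
    ext x
    exact LinearMap.congr_fun (hf g) x⟩

lemma simple_iff_absIrr {G : Type} [Group G] [Finite G] (V : FDRep ℂ G) :
    Simple V ↔ AbsIrr (W := V) V.ρ := by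
  rw [FDRep.simple_iff_end_is_rank_one]
  constructor
  · intro h
    have hnt : Nontrivial V := by
      by_contra hcon
      rw [not_nontrivial_iff_subsingleton] at hcon
      have : Subsingleton (V ⟶ V) := ⟨fun a b => by
        ext x
        exact Subsingleton.elim (α := V) _ _⟩
      rw [Module.finrank_zero_of_subsingleton] at h
      omega
    refine ⟨hnt, fun f hf => ?_⟩
    have h1 : (𝟙 V : V ⟶ V) ≠ 0 := by
      intro h0
      obtain ⟨x, hx⟩ := exists_ne (0 : V)
      apply hx
      have := congrArg (fun t : V ⟶ V => t.hom.hom.hom x) h0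
      exact this
    obtain ⟨c, hc⟩ := (finrank_eq_one_iff_of_nonzero' _ h1).mp h (endHom V f hf)
    refine ⟨c, ?_⟩
    ext x
    have := congrArg (fun t : V ⟶ V => t.hom.hom.hom x) hc
    exact this.symm
  · rintro ⟨hnt, h⟩
    have h1 : (𝟙 V : V ⟶ V) ≠ 0 := by
      intro h0
      obtain ⟨x, hx⟩ := exists_ne (0 : V)
      apply hx
      have := congrArg (fun t : V ⟶ V => t.hom.hom.hom x) h0
      exact this
    rw [finrank_eq_one_iff_of_nonzero' _ h1]
    intro w
    obtain ⟨c, hc⟩ := h w.hom.hom.hom (fun g => by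
      ext x
      have := congrArg (fun t => t.hom.hom x) (w.comm g)
      exact this)
    refine ⟨c, ?_⟩
    ext x
    exact (LinearMap.congr_fun hc x).symm

lemma irrChar_of_absIrr {G W : Type} [Group G] [Finite G] [AddCommGroup W] [Module ℂ W]
    [Module.Finite ℂ W] (ρ : G →* (W →ₗ[ℂ] W)) (h : AbsIrr ρ) (f : G → ℂ)
    (hf : ∀ g, f g = LinearMap.trace ℂ W (ρ g)) :
    ∃ V : FDRep ℂ G, Simple V ∧ f = FDRep.character V :=
  ⟨FDRep.of ρ, (simple_iff_absIrr _).2 h, funext hf⟩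

/-- a representation with irreducible character is irreducible -/
lemma absIrr_of_char {G W : Type} [Group G] [Finite G] [AddCommGroup W] [Module ℂ W]
    [Module.Finite ℂ W] (ρ : G →* (W →ₗ[ℂ] W)) (V : FDRep ℂ G) (hV : Simple V)
    (hf : ∀ g, V.character g = LinearMap.trace ℂ W (ρ g)) : AbsIrr ρ := by
  have := Fintype.ofFinite G
  refine (simple_iff_absIrr (FDRep.of ρ)).1 ?_
  have e : (FDRep.of ρ).character = V.character := (funext hf).symm
  rw [FDRep.simple_iff_char_is_norm_one] at hV ⊢
  rw [e]; exact hV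

lemma exists_mem_eq {G : Type} [Group G] [Finite G] (V : FDRep ℂ G) (hV : Simple V)
    (s : Finset (G → ℂ)) (hs : ∀ μ ∈ s, ∃ V : FDRep ℂ G, Simple V ∧ μ = FDRep.character V)
    (e : (G → ℂ) → ℕ) (h : ∀ x, V.character x = ∑ μ ∈ s, (e μ : ℂ) * μ x) :
    V.character ∈ s := by
  classical
  have := Fintype.ofFinite G
  have : Invertible (Nat.card G : ℂ) := invertibleOfNonzero (by simp)
  by_contra hcon
  have h1 := FDRep.char_orthonormal V V
  rw [if_pos ⟨Iso.refl _⟩] at h1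
  have h2 : ∀ μ ∈ s, ∑ g, μ g * V.character g⁻¹ = 0 := by
    intro μ hμ
    obtain ⟨W, hW, rfl⟩ := hs μ hμ
    have h3 := FDRep.char_orthonormal W V
    rw [if_neg] at h3
    · simpa using h3
    · rintro ⟨i⟩
      exact hcon (FDRep.char_iso i ▸ hμ)
  have h4 : ∑ g, V.character g * V.character g⁻¹ = 0 := by
    conv_lhs => enter [2, g]; rw [h g]
    simp_rw [Finset.sum_mul]
    rw [Finset.sum_comm]
    refine Finset.sum_eq_zero fun μ hμ => ?_
    simp_rw [mul_assoc, ← Finset.mul_sum]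
    rw [h2 μ hμ, mul_zero]
  rw [h4] at h1
  simp at h1

/-- one-dimensional characters -/
lemma absIrr_linear {G : Type} [Group G] (ν : G →* ℂ) :
    AbsIrr ((Algebra.lmul ℂ ℂ : ℂ →ₐ[ℂ] _).toMonoidHom.comp ν : G →* (ℂ →ₗ[ℂ] ℂ)) := by
  refine ⟨inferInstance, fun f _ => ⟨f 1, ?_⟩⟩
  ext; simp

lemma linear_of_trace {G W : Type} [Group G] [AddCommGroup W] [Module ℂ W]
    [Module.Finite ℂ W] (ρ : G →* (W →ₗ[ℂ] W)) (h1 : LinearMap.trace ℂ W (ρ 1) = 1) :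
    ∃ ν : G →* ℂ, ∀ g, ν g = LinearMap.trace ℂ W (ρ g) := by
  have hd : Module.finrank ℂ W = 1 := by
    rw [map_one, LinearMap.trace_one] at h1
    exact_mod_cast h1
  refine ⟨LinearMap.det.comp ρ, fun g => ?_⟩
  obtain ⟨v, hv, hb⟩ := finrank_eq_one_iff'.1 hd
  obtain ⟨c, hc⟩ := hb (ρ g v)
  have : ρ g = c • (1 : W →ₗ[ℂ] W) := by
    ext w
    obtain ⟨d, rfl⟩ := hb w
    simp [← hc, smul_smul, mul_comm]
  simp [this, hd, LinearMap.trace_one]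

/-- Späth's extension criterion ([TypD], Proposition 2.2; here without the equivariance
statements): let `K ⊴ M` be finite groups with subgroups `K₀, V̂ ≤ M` such that
`K = K₀·(K ∩ V̂)`, `Ĥ := K ∩ V̂ ≤ Z(K)` and `M = K·V̂`. Let `𝕂 ⊆ Irr(K)` be `M`-stable
such that each `λ ∈ 𝕂` restricts to `K₀` as a positive multiple of an irreducible
character in `𝕂₀ ⊆ Irr(K₀)`. Suppose there exist extension maps with respect to
`Ĥ ⊴ V̂` and with respect to `K₀ ⊴ K₀ ⋊ ε(V̂)` for `𝕂₀`, where `ε : V̂ → Q = V̂/Ĥ`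
is the canonical epimorphism and the semidirect product is formed via the induced
action `φ`. Then every `λ ∈ 𝕂` extends to its inertia group `M_λ`. -/
theorem extension_to_inertia_group
    (M : Type) [Group M] [Fintype M]
    (K K₀ V : Subgroup M) [hK : K.Normal] (hK₀K : K₀ ≤ K)
    -- (a)(i): K = K₀·(K ∩ V̂) and Ĥ := K ∩ V̂ ≤ Z(K)
    (hKprod : ∀ x ∈ K, ∃ a ∈ K₀, ∃ h ∈ K ⊓ V, x = a * h)
    (hHcen : ∀ h ∈ K ⊓ V, ∀ k ∈ K, h * k = k * h)
    -- (a)(ii): M = K·V̂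
    (hMprod : ∀ m : M, ∃ k ∈ K, ∃ v ∈ V, m = k * v)
    -- V̂ normalizes K₀ (needed to form K₀ ⋊ ε(V̂))
    (hVK₀ : ∀ v ∈ V, ∀ x ∈ K₀, v * x * v⁻¹ ∈ K₀)
    -- the M-stable set 𝕂 ⊆ Irr(K)
    (𝕂 : Set (K → ℂ)) (h𝕂irr : ∀ lam ∈ 𝕂, IsIrrChar K lam)
    (h𝕂stable : ∀ m : M, ∀ lam ∈ 𝕂,
      (fun k : K => lam ⟨m * k * m⁻¹, hK.conj_mem k.1 k.2 m⟩) ∈ 𝕂)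
    -- (b): the set 𝕂₀ of irreducible constituents of restrictions to K₀
    (𝕂₀ : Set (K₀ → ℂ)) (h𝕂₀irr : ∀ μ ∈ 𝕂₀, IsIrrChar K₀ μ)
    (hres : ∀ lam ∈ 𝕂, ∃ s : Finset (K₀ → ℂ), (↑s : Set ((↥K₀) → ℂ)) ⊆ 𝕂₀ ∧
      ∃ e : ((↥K₀) → ℂ) → ℕ,
        ∀ x : K₀, lam ⟨x, hK₀K x.2⟩ = ∑ μ ∈ s, (e μ : ℂ) * μ x)
    -- (b)(i): an extension map with respect to Ĥ ⊴ V̂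
    (hextH : ∀ μ : (K ⊓ V : Subgroup M) → ℂ, IsIrrChar (K ⊓ V : Subgroup M) μ →
      ∃ (hle : (K ⊓ V : Subgroup M) ≤ inertia (K ⊓ V) V (conj_mem_inf hK) μ)
        (Λ : (inertia (K ⊓ V) V (conj_mem_inf hK) μ : Subgroup M) → ℂ),
        IsIrrChar _ Λ ∧ IsExtension hle μ Λ)
    -- ε : V̂ → Q = V̂/Ĥ, the canonical epimorphism
    (Q : Type) [Group Q] (ε : V →* Q) (hεsurj : Function.Surjective ε)
    (hεker : ∀ v : V, ε v = 1 ↔ (v : M) ∈ K ⊓ V)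
    -- the induced action of Q = ε(V̂) on K₀
    (φ : Q →* MulAut K₀)
    (hφ : ∀ (v : V) (x : K₀), ((φ (ε v) x : K₀) : M) = (v : M) * (x : M) * (v : M)⁻¹)
    -- (b)(ii): an extension map with respect to K₀ ⊴ K₀ ⋊ ε(V̂) for 𝕂₀
    (hextK₀ : ∀ lam₀ ∈ 𝕂₀,
      ∃ (hle : (SemidirectProduct.rightHom : K₀ ⋊[φ] Q →* Q).ker ≤
          inertia (SemidirectProduct.rightHom : K₀ ⋊[φ] Q →* Q).ker ⊤
            (fun b _ a ha => (MonoidHom.normal_ker _).conj_mem a ha b)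
            (fun x => lam₀ (x : K₀ ⋊[φ] Q).left))
        (Λ₀ : (inertia (SemidirectProduct.rightHom : K₀ ⋊[φ] Q →* Q).ker ⊤
            (fun b _ a ha => (MonoidHom.normal_ker _).conj_mem a ha b)
            (fun x => lam₀ (x : K₀ ⋊[φ] Q).left) : Subgroup (K₀ ⋊[φ] Q)) → ℂ),
        IsIrrChar _ Λ₀ ∧ IsExtension hle (fun x => lam₀ (x : K₀ ⋊[φ] Q).left) Λ₀) :
    -- conclusion: every λ ∈ 𝕂 extends to its inertia group M_λ
    ∀ lam ∈ 𝕂,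
      ∃ (hle : K ≤ inertia K ⊤ (fun b _ a ha => hK.conj_mem a ha b) lam)
        (Λ : (inertia K ⊤ (fun b _ a ha => hK.conj_mem a ha b) lam : Subgroup M) → ℂ),
        IsIrrChar _ Λ ∧ IsExtension hle lam Λ := by
  intro lam hlam
  have hinert : ∀ m : M, m ∈ inertia K ⊤ (fun b _ a ha => hK.conj_mem a ha b) lam ↔
      ∀ k : K, lam ⟨m * k * m⁻¹, hK.conj_mem k.1 k.2 m⟩ = lam k :=
    fun m => ⟨fun ⟨_, h⟩ => h, fun h => ⟨trivial, h⟩⟩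
  obtain ⟨W, hW, hlamW⟩ := h𝕂irr lam hlam
  have hWabs : AbsIrr (W := W) W.ρ := (simple_iff_absIrr W).1 hW
  have hlam_tr : ∀ k, lam k = LinearMap.trace ℂ W (W.ρ k) := fun k => by rw [hlamW]; rfl
  have hWnt := hWabs.1
  have hdW : (Module.finrank ℂ W : ℂ) ≠ 0 := by
    exact_mod_cast (Module.finrank_pos (R := ℂ) (M := W)).ne'
  -- the central character
  let H : Subgroup M := K ⊓ V
  let iH : H →* K := Subgroup.inclusion inf_le_left
  let i₀ : K₀ →* K := Subgroup.inclusion hK₀K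
  have hscal : ∀ h : H, ∃ c : ℂ, W.ρ (iH h) = c • 1 := fun h => hWabs.2 _ fun g => by
    rw [← map_mul, ← map_mul]
    congr 1
    exact Subtype.ext (hHcen h h.2 g g.2)
  choose ν' hν' using hscal
  have hinj : ∀ c d : ℂ, c • (1 : W →ₗ[ℂ] W) = d • 1 → c = d := by
    intro c d h
    obtain ⟨w, hw⟩ := exists_ne (0 : W)
    exact smul_left_injective ℂ hw (LinearMap.congr_fun h w)
  let ν : H →* ℂ :=
    { toFun := ν'
      map_one' := hinj _ _ (by rw [← hν', map_one, map_one, one_smul])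
      map_mul' := fun a b => hinj _ _ (by
        rw [← hν', map_mul, map_mul, hν', hν', smul_mul_smul_comm, one_mul]) }
  have hν : ∀ h : H, W.ρ (iH h) = ν h • 1 := hν'
  have hlamprod : ∀ (a : K) (h : H), lam (a * iH h) = lam a * ν h := by
    intro a h
    rw [hlam_tr, hlam_tr, map_mul, hν, mul_smul_comm, mul_one, map_smul, smul_eq_mul, mul_comm]
  have hlam1 : lam 1 = Module.finrank ℂ W := by
    rw [hlam_tr, map_one, LinearMap.trace_one]
  -- the restriction to K₀
  let ρ₀ : K₀ →* (W →ₗ[ℂ] W) := W.ρ.comp i₀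
  have hρ₀ : AbsIrr (W := W) ρ₀ := by
    refine ⟨hWnt, fun f hf => hWabs.2 f fun g => ?_⟩
    obtain ⟨a, ha, h, hh, e⟩ := hKprod g g.2
    have : g = i₀ ⟨a, ha⟩ * iH ⟨h, hh⟩ := Subtype.ext e
    have h1 : f * W.ρ (i₀ ⟨a, ha⟩) = W.ρ (i₀ ⟨a, ha⟩) * f := hf _
    rw [this, map_mul, hν, mul_smul_comm, mul_one, mul_smul_comm, smul_mul_assoc, h1]
  let lam₀ : K₀ → ℂ := fun x => lam (i₀ x)
  obtain ⟨W₀, hW₀, hW₀c⟩ := irrChar_of_absIrr (W := W) ρ₀ hρ₀ lam₀ (fun g => hlam_tr _)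
  have hlam₀ : lam₀ ∈ 𝕂₀ := by
    obtain ⟨s, hs, e, he⟩ := hres lam hlam
    apply hs
    rw [hW₀c]
    refine exists_mem_eq W₀ hW₀ s (fun μ hμ => h𝕂₀irr μ (hs hμ)) e ?_
    rw [← hW₀c]
    exact he
  -- extension of ν
  obtain ⟨hleν, Λν, ⟨Uν, -, hUν⟩, hextν⟩ := hextH (fun h => ν h)
    (irrChar_of_absIrr _ (absIrr_linear ν) _ (fun g => by
      have : ((Algebra.lmul ℂ ℂ : ℂ →ₐ[ℂ] _).toMonoidHom.comp ν : H →* (ℂ →ₗ[ℂ] ℂ)) g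
          = ν g • 1 := by ext; simp
      rw [this, map_smul, LinearMap.trace_one]; simp))
  obtain ⟨νt, hνt⟩ := linear_of_trace (W := Uν) Uν.ρ (by
    have h := hextν (1 : H)
    have h' : ν 1 = 1 := map_one ν
    rw [hUν] at h
    exact h.trans h')
  have hνtH : ∀ h : H, νt ⟨h, hleν h.2⟩ = ν h := fun h => by
    have h2 := hextν h
    rw [hUν] at h2
    rw [hνt]
    exact h2
  -- extension of lam₀
  obtain ⟨hle₀, Λ₀, ⟨U, -, hU⟩, hext₀⟩ := hextK₀ lam₀ hlam₀
  generalize hT : inertia (SemidirectProduct.rightHom : K₀ ⋊[φ] Q →* Q).ker ⊤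
            (fun b _ a ha => (MonoidHom.normal_ker _).conj_mem a ha b)
            (fun x => lam₀ (x : K₀ ⋊[φ] Q).left) = T at *
  have hinl : ∀ a : K₀, (SemidirectProduct.inl a : K₀ ⋊[φ] Q) ∈
      (SemidirectProduct.rightHom : K₀ ⋊[φ] Q →* Q).ker := fun a => by
    rw [MonoidHom.mem_ker, SemidirectProduct.rightHom_inl]
  let j : K₀ →* T := SemidirectProduct.inl.codRestrict T (fun a => hle₀ (hinl a))
  have htrj : ∀ a : K₀, LinearMap.trace ℂ U (U.ρ (j a)) = lam₀ a := by
    intro a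
    have := hext₀ ⟨_, hinl a⟩
    rw [hU] at this
    exact this
  have hUabs : AbsIrr (W := U) (U.ρ.comp j) := by
    refine absIrr_of_char (W := U) _ W₀ hW₀ fun g => ?_
    rw [← hW₀c]
    exact (htrj g).symm
  have hdU : Module.finrank ℂ U = Module.finrank ℂ W := by
    have := htrj 1
    rw [map_one, map_one, LinearMap.trace_one] at this
    have h2 : lam₀ 1 = lam 1 := congrArg lam (map_one i₀)
    rw [h2, hlam1] at this
    exact_mod_cast this
  -- elements of K₀ ∩ V act as scalars
  have hz : ∀ (z : M) (hz₀ : z ∈ K₀) (hzH : z ∈ H), U.ρ (j ⟨z, hz₀⟩) = ν ⟨z, hzH⟩ • 1 := by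
    intro z hz₀ hzH
    obtain ⟨c, hc⟩ := hUabs.2 (U.ρ (j ⟨z, hz₀⟩)) (fun g => by
      change _ * U.ρ (j g) = U.ρ (j g) * _
      rw [← map_mul, ← map_mul, ← map_mul, ← map_mul]
      congr 2
      exact Subtype.ext (hHcen z hzH g (hK₀K g.2)))
    have h1 := htrj ⟨z, hz₀⟩
    have h2 : lam₀ ⟨z, hz₀⟩ = lam 1 * ν ⟨z, hzH⟩ := by
      rw [← hlamprod, one_mul]; rfl
    rw [h2, hc, map_smul, LinearMap.trace_one, hdU, hlam1, smul_eq_mul, mul_comm] at h1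
    rw [hc, mul_left_cancel₀ hdW h1]
  -- elements of V fixing lam
  generalize hI : inertia K ⊤ (fun b _ a ha => hK.conj_mem a ha b) lam = I at *
  have hVν : ∀ v, v ∈ V → v ∈ I → v ∈ inertia (K ⊓ V) V (conj_mem_inf hK) (fun h => ν h) := by
    intro v hv hvI
    refine ⟨hv, fun h => ?_⟩
    have h1 := (hinert v).1 hvI (iH h)
    have h2 := hlamprod 1 h
    have h3 := hlamprod 1 ⟨v * h * v⁻¹, conj_mem_inf hK v hv h h.2⟩
    rw [one_mul] at h2 h3
    rw [h2] at h1
    rw [hlam1] at h1 h3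
    exact mul_left_cancel₀ hdW (h3.symm.trans h1)
  have hVT : ∀ (a : K₀) (v : V), (v : M) ∈ I → (⟨a, ε v⟩ : K₀ ⋊[φ] Q) ∈ T := by
    intro a v hvI
    have : (⟨a, ε v⟩ : K₀ ⋊[φ] Q) = SemidirectProduct.inl a * SemidirectProduct.inr (ε v) := by
      ext <;> simp
    rw [this]
    refine T.mul_mem (j a).2 ?_
    rw [← hT]
    refine ⟨trivial, ?_⟩
    rintro ⟨⟨x, q⟩, hx⟩
    have hq : q = 1 := hx
    subst hq
    have h1 := (hinert v).1 hvI (i₀ x)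
    refine Eq.trans ?_ h1
    refine congrArg lam (Subtype.ext ?_)
    have := hφ v x
    simpa [i₀] using this
  have hKI : K ≤ I := by
    intro k hk
    refine (hinert k).2 fun x => ?_
    have : (⟨k * x * k⁻¹, hK.conj_mem x.1 x.2 k⟩ : K) = ⟨k, hk⟩ * x * ⟨k, hk⟩⁻¹ := rfl
    rw [this, hlamW, FDRep.char_conj]
  have hdec : ∀ m : I, ∃ (a : K₀) (v : V), (m : M) = a * v ∧ (v : M) ∈ I := by
    intro m
    obtain ⟨k, hk, v, hv, e⟩ := hMprod m
    obtain ⟨a, ha, h, hh, rfl⟩ := hKprod k hk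
    refine ⟨⟨a, ha⟩, ⟨h * v, V.mul_mem hh.2 hv⟩, by rw [e, mul_assoc], ?_⟩
    have : h * v = a⁻¹ * m := by rw [e]; group
    change h * v ∈ I
    rw [this]
    exact I.mul_mem (I.inv_mem (hKI (hK₀K ha))) m.2
  let F : (a : K₀) → (v : V) → (v : M) ∈ I → (U →ₗ[ℂ] U) := fun a v hv =>
    νt ⟨v, hVν v v.2 hv⟩ • U.ρ ⟨⟨a, ε v⟩, hVT a v hv⟩
  have hFmul : ∀ (a : K₀) (v : V) (hv : (v : M) ∈ I) (a' : K₀) (v' : V) (hv' : (v' : M) ∈ I),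
      F a v hv * F a' v' hv' = F (a * φ (ε v) a') (v * v') (I.mul_mem hv hv') := by
    intro a v hv a' v' hv'
    simp only [F]
    rw [smul_mul_smul_comm, ← map_mul, ← map_mul]
    congr 2
    congr 1
    refine Subtype.ext ?_
    ext <;> simp
  have hFj : ∀ (a : K₀) (v : V) (hv : (v : M) ∈ I),
      F a v hv = U.ρ (j a) * F 1 v hv := by
    intro a v hv
    simp only [F]
    rw [mul_smul_comm, ← map_mul]
    congr 2
    refine Subtype.ext ?_
    ext <;> simp [j]
  have hFH : ∀ (h v : V) (hh : (h : M) ∈ H) (hv : (v : M) ∈ I) (hhv : ((h * v : V) : M) ∈ I),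
      F 1 (h * v) hhv = ν ⟨h, hh⟩ • F 1 v hv := by
    intro h v hh hv hhv
    simp only [F]
    rw [← hνtH ⟨h, hh⟩, smul_smul, ← map_mul]
    have : ε (h * v) = ε v := by rw [map_mul, (hεker h).2 hh, one_mul]
    congr 2
    refine Subtype.ext ?_
    ext <;> simp [this]
  have hFwd : ∀ (a : K₀) (v : V) (hv : (v : M) ∈ I) (a' : K₀) (v' : V) (hv' : (v' : M) ∈ I),
      (a : M) * v = a' * v' → F a v hv = F a' v' hv' := by
    intro a v hv a' v' hv' e
    have hzK : ((a'⁻¹ * a : K₀) : M) = ((v' * v⁻¹ : V) : M) := by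
      push_cast
      rw [inv_mul_eq_iff_eq_mul, ← mul_assoc, ← e]; group
    have hzH : ((v' * v⁻¹ : V) : M) ∈ H := ⟨hzK ▸ hK₀K (a'⁻¹ * a).2, (v' * v⁻¹).2⟩
    have hzI : ((v' * v⁻¹ * v : V) : M) ∈ I := by simpa using hv'
    have e1 : F a' v' hv' = U.ρ (j a') * F 1 (v' * v⁻¹ * v) hzI := by
      rw [hFj _ _ hv']; congr 2; simp
    rw [e1, hFH (v' * v⁻¹) v hzH hv hzI]
    have h1 := hz _ (a'⁻¹ * a).2 (hzK ▸ hzH)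
    have h2 : a = a' * (a'⁻¹ * a) := by group
    conv_lhs => rw [hFj _ _ hv, h2, map_mul, map_mul]
    have h3 : U.ρ (j (a'⁻¹ * a)) = ν ⟨_, hzH⟩ • 1 := by
      rw [← Subtype.coe_eta (a'⁻¹ * a) (a'⁻¹ * a).2, h1]
      congr 2
      exact Subtype.ext hzK
    rw [h3]
    simp
  choose α β hαβ hβI using hdec
  have hF1 : F 1 1 I.one_mem = 1 := by
    have e1 : (⟨((1 : V) : M), hVν _ (1 : V).2 I.one_mem⟩ :
        inertia (K ⊓ V) V (conj_mem_inf hK) (fun h => ν h)) = 1 := rfl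
    have e2 : (⟨⟨1, ε 1⟩, hVT 1 1 I.one_mem⟩ : T) = 1 := by
      refine Subtype.ext ?_
      ext <;> simp
    simp only [F]
    rw [e1, e2, map_one, map_one, one_smul]
  let Φ : I →* (U →ₗ[ℂ] U) :=
    { toFun := fun m => F (α m) (β m) (hβI m)
      map_one' := by
        rw [← hF1]
        refine hFwd _ _ (hβI 1) _ _ I.one_mem ?_
        rw [← hαβ]; simp
      map_mul' := fun m n => by
        rw [hFmul _ _ (hβI m) _ _ (hβI n)]
        refine hFwd _ _ (hβI (m * n)) _ _ (I.mul_mem (hβI m) (hβI n)) ?_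
        rw [← hαβ]
        push_cast
        rw [hφ, hαβ m, hαβ n]
        group }
  have hΦ : ∀ (m : I) (a : K₀) (v : V) (hv : (v : M) ∈ I), (m : M) = a * v →
      Φ m = F a v hv := fun m a v hv e => hFwd _ _ (hβI m) _ _ hv ((hαβ m).symm.trans e)
  have hΦK : ∀ (a : K₀) (h : V) (hh : (h : M) ∈ H) (m : I), (m : M) = a * h →
      Φ m = ν ⟨h, hh⟩ • U.ρ (j a) := by
    intro a h hh m e
    have hhI : (h : M) ∈ I := hKI hh.1
    have hhI' : ((h * 1 : V) : M) ∈ I := by simpa using hhI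
    rw [hΦ m a (h * 1) hhI' (by simpa using e), hFj _ _ hhI', hFH h 1 hh I.one_mem hhI', hF1,
      mul_smul_comm, mul_one]
  have hΦabs : AbsIrr (W := U) Φ := by
    refine ⟨hUabs.1, fun f hf => hUabs.2 f fun a => ?_⟩
    have h1 := hΦK a 1 H.one_mem ⟨a, hKI (hK₀K a.2)⟩ (by simp)
    have h2 : ν ⟨((1 : V) : M), H.one_mem⟩ = 1 := map_one ν
    rw [h2, one_smul] at h1
    have h3 := hf ⟨a, hKI (hK₀K a.2)⟩
    rw [h1] at h3
    exact h3
  refine ⟨hKI, fun m => LinearMap.trace ℂ U (Φ m),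
    irrChar_of_absIrr (W := U) Φ hΦabs _ (fun _ => rfl), ?_⟩
  intro k
  obtain ⟨a, ha, h, hh, e⟩ := hKprod k k.2
  have h1 := hΦK ⟨a, ha⟩ ⟨h, hh.2⟩ hh ⟨k, hKI k.2⟩ e
  have h2 : k = i₀ ⟨a, ha⟩ * iH ⟨h, hh⟩ := Subtype.ext e
  have h3 : lam k = lam (i₀ ⟨a, ha⟩) * ν ⟨h, hh⟩ := by rw [← hlamprod, ← h2]
  change LinearMap.trace ℂ U (Φ ⟨k, hKI k.2⟩) = lam k
  rw [h1, map_smul, htrj, h3, smul_eq_mul, mul_comm]
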